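/- For every initial state x₀ ∈ X, the limsup average cost of the decentralized policy satisfies J̄(μ_d, x₀) ≤ 2 · g(m*), i.e. at most twice the optimal value of the k-median problem for (S, d, p). -/

import Mathlib

open Filter Finset

/-- Distribution of the chain after `t` steps under kernel `K`, started at `x₀`:
the `t`-fold monadic bind of `K` applied to the point mass at `x₀`. -/
noncomputable def chainDist {X : Type*} (K : X → PMF X) (x₀ : X) : ℕ → PMF X
  | 0 => PMF.pure x₀
  | t + 1 => (chainDist K x₀ t).bind K

/-- Expectation of `f` under a PMF on a finite type. -/
noncomputable def pmfExp {X : Type*} [Fintype X] (q : PMF X) (f : X → ℝ) : ℝ :=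
  ∑ x, (q x).toReal * f x

/-- The average cost over periods `0,…,T` of running the Markov chain with step
kernel `K` and per-stage cost `c`, started at `x₀`. -/
noncomputable def avgCost {X : Type*} [Fintype X] (K : X → PMF X) (c : X → ℝ)
    (x₀ : X) (T : ℕ) : ℝ :=
  (1 / (T + 1 : ℝ)) * ∑ t ∈ Finset.range (T + 1), pmfExp (chainDist K x₀ t) c

/-- Step kernel of the stochastic `k`-server problem under policy `μ`: the state is
`(x̂, x₁, …, x_k)`; server `μ x` relocates to the request location `x.1` and the next
request is drawn from `p`. -/
noncomputable def kServerKernel {S : Type*} {k : ℕ} (p : PMF S)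
    (μ : S × (Fin k → S) → Fin k) (x : S × (Fin k → S)) : PMF (S × (Fin k → S)) :=
  p.map (fun s => (s, Function.update x.2 (μ x) x.1))

/-- Per-stage cost of the stochastic `k`-server problem under policy `μ`:
the distance from the dispatched server to the request location. -/
noncomputable def kServerCost {S : Type*} [MetricSpace S] {k : ℕ}
    (μ : S × (Fin k → S) → Fin k) (x : S × (Fin k → S)) : ℝ :=
  dist (x.2 (μ x)) x.1

/-- The `k`-median objective `g(m) = Σ_s p(s) · min_i d(m_i, s)`. -/
noncomputable def kMedian {S : Type*} [Fintype S] [MetricSpace S] {k : ℕ} [NeZero k]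
    (p : PMF S) (m : Fin k → S) : ℝ :=
  ∑ s, (p s).toReal * Finset.univ.inf' Finset.univ_nonempty (fun i => dist (m i) s)

theorem pmfExp_pure {X : Type*} [Fintype X] (a : X) (f : X → ℝ) :
    pmfExp (PMF.pure a) f = f a := by
  classical
  rw [pmfExp, Finset.sum_eq_single a] <;> simp +contextual [PMF.pure_apply]

theorem pmfExp_bind {X Y : Type*} [Fintype X] [Fintype Y] (q : PMF X) (K : X → PMF Y)
    (f : Y → ℝ) : pmfExp (q.bind K) f = pmfExp q (fun x => pmfExp (K x) f) := by
  have h (y : Y) : (q.bind K y).toReal = ∑ x, (q x).toReal * (K x y).toReal := by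
    rw [PMF.bind_apply, tsum_fintype,
      ENNReal.toReal_sum fun x _ => ENNReal.mul_ne_top (q.apply_ne_top x) ((K x).apply_ne_top y)]
    simp only [ENNReal.toReal_mul]
  simp only [pmfExp, h, Finset.sum_mul, Finset.mul_sum]
  rw [Finset.sum_comm]
  simp only [mul_assoc]

theorem pmfExp_map {X Y : Type*} [Fintype X] [Fintype Y] (q : PMF X) (e : X → Y)
    (f : Y → ℝ) : pmfExp (q.map e) f = pmfExp q (fun x => f (e x)) := by
  rw [← PMF.bind_pure_comp, pmfExp_bind]
  simp only [Function.comp_apply, pmfExp_pure]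

theorem pmfExp_mono {X : Type*} [Fintype X] (q : PMF X) {f g : X → ℝ} (h : ∀ x, f x ≤ g x) :
    pmfExp q f ≤ pmfExp q g :=
  Finset.sum_le_sum fun x _ => mul_le_mul_of_nonneg_left (h x) ENNReal.toReal_nonneg

theorem pmfExp_add {X : Type*} [Fintype X] (q : PMF X) (f g : X → ℝ) :
    pmfExp q (fun x => f x + g x) = pmfExp q f + pmfExp q g := by
  simp only [pmfExp, mul_add, Finset.sum_add_distrib]

theorem pmfExp_const_mul {X : Type*} [Fintype X] (q : PMF X) (a : ℝ) (f : X → ℝ) :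
    pmfExp q (fun x => a * f x) = a * pmfExp q f := by
  simp only [pmfExp, Finset.mul_sum, mul_left_comm]

theorem pmfExp_const {X : Type*} [Fintype X] (q : PMF X) (a : ℝ) :
    pmfExp q (fun _ => a) = a := by
  have h : ∑ x, (q x).toReal = 1 := by
    rw [← ENNReal.toReal_sum fun x _ => q.apply_ne_top x, ← tsum_fintype (L := .unconditional X),
      q.tsum_coe, ENNReal.toReal_one]
  rw [pmfExp, ← Finset.sum_mul, h, one_mul]

theorem pmfExp_nonneg {X : Type*} [Fintype X] (q : PMF X) {f : X → ℝ} (h : ∀ x, 0 ≤ f x) :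
    0 ≤ pmfExp q f :=
  Finset.sum_nonneg fun x _ => mul_nonneg ENNReal.toReal_nonneg (h x)

/-- Telescoping a drift condition on the potential `V`. -/
theorem sum_pmfExp_chainDist_add_le {X : Type*} [Fintype X] (K : X → PMF X) (c V : X → ℝ) (b : ℝ)
    (drift : ∀ x, c x + pmfExp (K x) V ≤ V x + b) (x₀ : X) (n : ℕ) :
    ∑ t ∈ Finset.range n, pmfExp (chainDist K x₀ t) c + pmfExp (chainDist K x₀ n) V ≤
      V x₀ + n * b := by
  induction n with
  | zero => simp [chainDist, pmfExp_pure]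
  | succ n ih =>
    have h := pmfExp_mono (chainDist K x₀ n) drift
    rw [pmfExp_add, pmfExp_add, pmfExp_const, ← pmfExp_bind] at h
    rw [Finset.sum_range_succ, chainDist]
    push_cast
    linarith

/-- Foster–Lyapunov bound on the limsup average cost of a finite Markov chain. -/
theorem limsup_avgCost_le_of_drift {X : Type*} [Fintype X] (K : X → PMF X) (c V : X → ℝ) (b : ℝ)
    (hc : ∀ x, 0 ≤ c x) (hV : ∀ x, 0 ≤ V x)
    (drift : ∀ x, c x + pmfExp (K x) V ≤ V x + b) (x₀ : X) :
    limsup (avgCost K c x₀) atTop ≤ b := by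
  have hlim : Tendsto (fun T : ℕ => V x₀ * (1 / ((T : ℝ) + 1)) + b) atTop (nhds b) := by
    simpa using (tendsto_one_div_add_atTop_nhds_zero_nat (𝕜 := ℝ)).const_mul (V x₀) |>.add_const b
  have hle (T : ℕ) : avgCost K c x₀ T ≤ V x₀ * (1 / ((T : ℝ) + 1)) + b := by
    have hsum := sum_pmfExp_chainDist_add_le K c V b drift x₀ (T + 1)
    have hVT := pmfExp_nonneg (chainDist K x₀ (T + 1)) hV
    have hT : (0 : ℝ) < T + 1 := by positivity
    push_cast at hsum
    calc avgCost K c x₀ T ≤ (1 / ((T : ℝ) + 1)) * (V x₀ + (T + 1) * b) :=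
          mul_le_mul_of_nonneg_left (by linarith) (by positivity)
      _ = V x₀ * (1 / ((T : ℝ) + 1)) + b := by field_simp
  have hnonneg (T : ℕ) : 0 ≤ avgCost K c x₀ T :=
    mul_nonneg (by positivity) (Finset.sum_nonneg fun t _ => pmfExp_nonneg _ hc)
  calc limsup (avgCost K c x₀) atTop
      ≤ limsup (fun T : ℕ => V x₀ * (1 / ((T : ℝ) + 1)) + b) atTop :=
        limsup_le_limsup (Eventually.of_forall hle)
          (isBoundedUnder_of ⟨0, hnonneg⟩ : IsBoundedUnder (· ≥ ·) atTop _).isCoboundedUnder_le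
          hlim.isBoundedUnder_le
    _ = b := hlim.limsup_eq

/-- Relocating server `i` to `a` changes only the `i`-th term of the total distance to `m`. -/
theorem sum_dist_update {S ι : Type*} [Fintype ι] [DecidableEq ι] [MetricSpace S]
    (m y : ι → S) (i : ι) (a : S) :
    ∑ j, dist (Function.update y i a j) (m j) + dist (y i) (m i) =
      ∑ j, dist (y j) (m j) + dist a (m i) := by
  rw [← Finset.add_sum_erase _ _ (Finset.mem_univ i),
    ← Finset.add_sum_erase _ (fun j => dist (y j) (m j)) (Finset.mem_univ i),
    Finset.sum_congr rfl fun j hj => by rw [Function.update_of_ne (Finset.ne_of_mem_erase hj)],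
    Function.update_self]
  ring

/-- The limsup average cost of the decentralized policy is at most twice the optimal
value of the `k`-median problem. -/
theorem decentralized_limsup_le_two_kMedian
    {S : Type*} [Fintype S] [Nonempty S] [MetricSpace S] {k : ℕ} [NeZero k]
    (p : PMF S) (mstar : Fin k → S)
    (hmstar : ∀ m : Fin k → S, kMedian p mstar ≤ kMedian p m)
    (μd : S × (Fin k → S) → Fin k)
    (hμd : ∀ x : S × (Fin k → S), ∀ j : Fin k,
      dist (mstar (μd x)) x.1 ≤ dist (mstar j) x.1)
    (x₀ : S × (Fin k → S)) :
    limsup (avgCost (kServerKernel p μd) (kServerCost μd) x₀) atTop ≤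
      2 * kMedian p mstar := by
  set h : S → ℝ := fun s => Finset.univ.inf' Finset.univ_nonempty fun i => dist (mstar i) s
  refine limsup_avgCost_le_of_drift _ _
    (fun x => ∑ j, dist (x.2 j) (mstar j) + 2 * h x.1) _ (fun x => dist_nonneg) (fun x => ?_)
    (fun x => ?_) x₀
  · exact add_nonneg (Finset.sum_nonneg fun j _ => dist_nonneg)
      (mul_nonneg zero_le_two (Finset.le_inf' _ _ fun i _ => dist_nonneg))
  · have hnearest : dist (mstar (μd x)) x.1 ≤ h x.1 := Finset.le_inf' _ _ fun j _ => hμd x j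
    have hmedian : pmfExp p h = kMedian p mstar := rfl
    have hupdate := sum_dist_update mstar x.2 (μd x) x.1
    have htriangle := dist_triangle (x.2 (μd x)) (mstar (μd x)) x.1
    rw [kServerKernel, pmfExp_map]
    dsimp only
    rw [pmfExp_add, pmfExp_const, pmfExp_const_mul, hmedian]
    rw [dist_comm x.1] at hupdate
    linarith
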